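/- arXiv:math/0401366 — 5 statements merged into one kernel-verified Lean document; each statement's English description precedes it below -/
import Mathlib

section
/- Let p be a prime number, let K be a field of characteristic p, and let a ≥ 1 be an integer. For every integer d₀ there exist an integer e ≥ 1 and an integer d ≥ d₀ with p not dividing d such that, setting q = p^e and k = d·p − a·q, one has k ≥ 1 and 2k < a·q, and in the quotient ring R = K[X,Y,Z]/(X^d + Y^d + Z^d) the images x, y, z of the variables satisfy x^(k+aq) + y^(k+aq) + z^(k+aq) = 0 (equivalently, (x^k, y^k, z^k) is a syzygy of (x^(aq), y^(aq), z^(aq)) of total degree dp) while x^k ≠ 0 in R. -/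
open MvPolynomial

/-- On a Fermat curve of positive degree, the first coordinate function is not nilpotent. -/
theorem mk_fermat_X_zero_pow_ne_zero (K : Type*) [Field K] {d : ℕ} (hd : d ≠ 0) (k : ℕ) :
    (Ideal.Quotient.mk
      (Ideal.span {(X 0 : MvPolynomial (Fin 3) K) ^ d + X 1 ^ d + X 2 ^ d}) (X 0)) ^ k ≠ 0 := by
  intro h
  rw [← map_pow, Ideal.Quotient.eq_zero_iff_mem, Ideal.mem_span_singleton] at h
  have h' := map_dvd (aeval ![(1 : Polynomial K), Polynomial.X, 0]) h
  simp only [map_add, map_pow, aeval_X, Matrix.cons_val, one_pow, zero_pow hd, add_zero] at h'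
  have hdeg := Polynomial.natDegree_eq_zero_of_isUnit (isUnit_of_dvd_one h')
  rw [add_comm, ← Polynomial.C_1, Polynomial.natDegree_X_pow_add_C] at hdeg
  exact hd hdeg

/-- Let p be a prime number, let K be a field of characteristic p, and let a ≥ 1 be an integer.
For every integer d₀ there exist an integer e ≥ 1 and an integer d ≥ d₀ with p not dividing d
such that, setting q = p^e and k = d·p − a·q, one has k ≥ 1 and 2k < a·q, and in the quotient
ring R = K[X,Y,Z]/(X^d + Y^d + Z^d) the images x, y, z of the variables satisfy
x^(k+aq) + y^(k+aq) + z^(k+aq) = 0 (i.e. (x^k, y^k, z^k) is a syzygy of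
(x^(aq), y^(aq), z^(aq)) of total degree dp) while x^k ≠ 0 in R. -/
theorem stmt_0 (p : ℕ) (hp : p.Prime) (K : Type*) [Field K] [CharP K p]
    (a : ℕ) (ha : 1 ≤ a) (d₀ : ℕ) :
    ∃ e d : ℕ, 1 ≤ e ∧ d₀ ≤ d ∧ ¬ p ∣ d ∧
      ∃ q k : ℕ, q = p ^ e ∧ k = d * p - a * q ∧ 1 ≤ k ∧ 2 * k < a * q ∧
        (Ideal.Quotient.mk
            (Ideal.span {(X 0 : MvPolynomial (Fin 3) K) ^ d + X 1 ^ d + X 2 ^ d})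
            (X 0)) ^ (k + a * q)
          + (Ideal.Quotient.mk
              (Ideal.span {(X 0 : MvPolynomial (Fin 3) K) ^ d + X 1 ^ d + X 2 ^ d})
              (X 1)) ^ (k + a * q)
          + (Ideal.Quotient.mk
              (Ideal.span {(X 0 : MvPolynomial (Fin 3) K) ^ d + X 1 ^ d + X 2 ^ d})
              (X 2)) ^ (k + a * q) = 0 ∧
        (Ideal.Quotient.mk
            (Ideal.span {(X 0 : MvPolynomial (Fin 3) K) ^ d + X 1 ^ d + X 2 ^ d})
            (X 0)) ^ k ≠ 0 := by
  have := Fact.mk hp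
  have hpow : d₀ + 2 < p ^ (d₀ + 2) := Nat.lt_pow_self hp.one_lt
  have hle : p ^ (d₀ + 2) ≤ a * p ^ (d₀ + 2) := Nat.le_mul_of_pos_left _ ha
  have hdp : (a * p ^ (d₀ + 2) + 1) * p = p + a * p ^ (d₀ + 3) := by ring
  refine ⟨d₀ + 3, a * p ^ (d₀ + 2) + 1, by omega, by omega, ?_, p ^ (d₀ + 3), p, rfl, by omega,
    hp.one_le, ?_, ?_, mk_fermat_X_zero_pow_ne_zero K (Nat.succ_ne_zero _) p⟩
  · rw [← Nat.dvd_add_iff_right (dvd_mul_of_dvd_right (dvd_pow_self p (by omega)) a)]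
    exact hp.not_dvd_one
  · calc 2 * p < a * p ^ (d₀ + 2) * p := Nat.mul_lt_mul_of_pos_right (by omega) hp.pos
      _ = a * p ^ (d₀ + 3) := by ring
  · simp only [← hdp, ← map_pow, ← map_add]
    rw [pow_mul, pow_mul, pow_mul, ← add_pow_char _ _ p, ← add_pow_char _ _ p,
      Ideal.Quotient.eq_zero_iff_mem]
    exact Ideal.pow_mem_of_mem _ (Ideal.mem_span_singleton_self _) p hp.pos
end

section
/- Let K be a field and let n ≥ 1 and m be integers with m < 2n. If f, g, h ∈ K[X,Y,Z] are homogeneous polynomials of degree m − n (or zero) satisfying f·X^n + g·Y^n + h·Z^n = 0, then f = g = h = 0. -/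
namespace MvPolynomial

/-- A syzygy `p` of the powers `X i ^ n` vanishes if `p i` has degree less than `n` in each
variable `X j` with `j ≠ i`. -/
theorem eq_zero_of_sum_mul_X_pow_eq_zero {σ R : Type*} [Fintype σ] [CommSemiring R] {n : ℕ}
    (p : σ → MvPolynomial σ R) (hdeg : ∀ i j, j ≠ i → degreeOf j (p i) < n)
    (hsum : ∑ i, p i * X i ^ n = 0) : p = 0 := by
  classical
  funext i
  ext d
  by_cases hd : d ∈ (p i).support
  · have hcoeff := congrArg (coeff (d + Finsupp.single i n)) hsum
    rw [coeff_sum, Finset.sum_eq_single i, X_pow_eq_monomial, coeff_mul_monomial, mul_one] at hcoeff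
    · simpa using hcoeff
    · intro j _ hji
      rw [X_pow_eq_monomial, coeff_mul_monomial', if_neg]
      intro hle
      have hnd : n ≤ d j := by simpa [hji.symm, Finsupp.single_apply] using hle j
      exact absurd (hnd.trans (monomial_le_degreeOf j hd)) (hdeg i j hji).not_ge
    · simp
  · simpa using hd

end MvPolynomial

open MvPolynomial

/-- Let K be a field and let n ≥ 1 and m be integers with m < 2n. If f, g, h ∈ K[X,Y,Z] are
homogeneous polynomials of degree m − n (or zero) satisfying f·X^n + g·Y^n + h·Z^n = 0,
then f = g = h = 0. -/
theorem stmt_3 (K : Type*) [Field K] (n : ℕ) (hn : 1 ≤ n) (m : ℤ) (hm : m < 2 * n)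
    (f g h : MvPolynomial (Fin 3) K)
    (hf : f = 0 ∨ ∃ r : ℕ, (r : ℤ) = m - n ∧ f.IsHomogeneous r)
    (hg : g = 0 ∨ ∃ r : ℕ, (r : ℤ) = m - n ∧ g.IsHomogeneous r)
    (hh : h = 0 ∨ ∃ r : ℕ, (r : ℤ) = m - n ∧ h.IsHomogeneous r)
    (hsyz : f * X 0 ^ n + g * X 1 ^ n + h * X 2 ^ n = 0) :
    f = 0 ∧ g = 0 ∧ h = 0 := by
  have hlt : ∀ q : MvPolynomial (Fin 3) K,
      (q = 0 ∨ ∃ r : ℕ, (r : ℤ) = m - n ∧ q.IsHomogeneous r) → ∀ j, degreeOf j q < n := by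
    rintro q (rfl | ⟨r, hr, hq⟩) j
    · rwa [degreeOf_zero]
    · have hle := (degreeOf_le_totalDegree q j).trans hq.totalDegree_le
      omega
  have hzero : ![f, g, h] = 0 := by
    refine eq_zero_of_sum_mul_X_pow_eq_zero (n := n) _ (fun i j _ ↦ hlt _ ?_ j) ?_
    · fin_cases i
      exacts [hf, hg, hh]
    · simpa [Fin.sum_univ_three] using hsyz
  exact ⟨congrFun hzero 0, congrFun hzero 1, congrFun hzero 2⟩
end

section
/- Let p ≥ 5 be a prime number, let K be a field of characteristic p, let b ≥ 1 and e ≥ 2 be integers, and set q = p^e, d = 2·b·p^(e−1) + 1, and u = (p+1)/2. Then in the polynomial ring K[X,Y], the polynomial (X^d + Y^d)^u does not belong to the ideal generated by X^(bq) and Y^(bq). -/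
open MvPolynomial

/-- The coefficient of `X ^ (d * m) * Y ^ (d * n)` in `(X ^ d + Y ^ d) ^ (m + n)`. -/
theorem coeff_X_pow_add_X_pow_pow {R : Type*} [CommSemiring R] {d : ℕ} (hd : d ≠ 0) (m n : ℕ) :
    coeff (Finsupp.single 0 (d * m) + Finsupp.single 1 (d * n))
      (((X 0 : MvPolynomial (Fin 2) R) ^ d + X 1 ^ d) ^ (m + n)) = ((m + n).choose m : R) := by
  have hterm (i j c : ℕ) :
      ((X 0 : MvPolynomial (Fin 2) R) ^ d) ^ i * (X 1 ^ d) ^ j * (c : MvPolynomial (Fin 2) R) =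
        monomial (Finsupp.single 0 (d * i) + Finsupp.single 1 (d * j)) (c : R) := by
    rw [← pow_mul, ← pow_mul, X_pow_eq_monomial, X_pow_eq_monomial, monomial_mul,
      ← map_natCast (C : R →+* MvPolynomial (Fin 2) R), mul_comm, C_mul_monomial]
    simp
  rw [add_pow, coeff_sum, Finset.sum_eq_single m]
  · rw [hterm, coeff_monomial, if_pos (by simp)]
  · intro i _ him
    rw [hterm, coeff_monomial, if_neg]
    intro h
    exact him (by simpa [hd] using DFunLike.congr_fun h 0)
  · simp

/-- A polynomial in `(X ^ k, Y ^ k)` has no monomial with both exponents less than `k`. -/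
theorem coeff_eq_zero_of_mem_span_X_pow {R : Type*} [CommSemiring R] {k : ℕ}
    {f : MvPolynomial (Fin 2) R}
    (hf : f ∈ Ideal.span {(X 0 : MvPolynomial (Fin 2) R) ^ k, X 1 ^ k})
    {s : Fin 2 →₀ ℕ} (h0 : s 0 < k) (h1 : s 1 < k) : coeff s f = 0 := by
  by_contra hs
  have himg : ({(X 0 : MvPolynomial (Fin 2) R) ^ k, X 1 ^ k} : Set (MvPolynomial (Fin 2) R)) =
      (fun t => monomial t (1 : R)) '' {Finsupp.single 0 k, Finsupp.single 1 k} := by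
    simp only [Set.image_pair, X_pow_eq_monomial]
  rw [himg, mem_ideal_span_monomial_image] at hf
  obtain ⟨t, rfl | rfl, hts⟩ := hf s (mem_support_iff.mpr hs)
  · exact h0.not_ge (by simpa using hts 0)
  · exact h1.not_ge (by simpa using hts 1)

/-- Let p ≥ 5 be a prime number, let K be a field of characteristic p, let b ≥ 1 and e ≥ 2
be integers, and set q = p^e, d = 2·b·p^(e−1) + 1, and u = (p+1)/2. Then in the polynomial
ring K[X,Y], the polynomial (X^d + Y^d)^u does not belong to the ideal generated by
X^(bq) and Y^(bq). -/
theorem stmt_9 (p : ℕ) (hp : p.Prime) (hp5 : 5 ≤ p) (K : Type*) [Field K] [CharP K p]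
    (b e q d u : ℕ) (hb : 1 ≤ b) (he : 2 ≤ e) (hq : q = p ^ e)
    (hd : d = 2 * b * p ^ (e - 1) + 1) (hu : u = (p + 1) / 2) :
    ((X 0 : MvPolynomial (Fin 2) K) ^ d + X 1 ^ d) ^ u ∉
      Ideal.span {(X 0 : MvPolynomial (Fin 2) K) ^ (b * q), X 1 ^ (b * q)} := by
  intro hmem
  subst hq hu
  obtain ⟨n, rfl⟩ : ∃ n, p = 2 * n + 1 := by
    obtain ⟨n, hn⟩ := hp.odd_of_ne_two (by omega)
    exact ⟨n, hn⟩
  obtain ⟨e, rfl⟩ : ∃ k, e = k + 2 := ⟨e - 2, by omega⟩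
  rw [show (2 * n + 1 + 1) / 2 = n + 1 by omega] at hmem
  rw [show e + 2 - 1 = e + 1 by omega] at hd
  have hle : n < b * (2 * n + 1) ^ (e + 1) := by
    have h1 : 2 * n + 1 ≤ (2 * n + 1) ^ (e + 1) := Nat.le_self_pow (by omega) _
    have h2 : (2 * n + 1) ^ (e + 1) ≤ b * (2 * n + 1) ^ (e + 1) := Nat.le_mul_of_pos_left _ hb
    omega
  have hbq : b * (2 * n + 1) ^ (e + 2) = (2 * n + 1) * (b * (2 * n + 1) ^ (e + 1)) := by ring
  rw [mul_assoc] at hd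
  rw [hbq] at hmem
  generalize b * (2 * n + 1) ^ (e + 1) = N at *
  have hcoeff := coeff_eq_zero_of_mem_span_X_pow hmem
    (s := Finsupp.single 0 (d * n) + Finsupp.single 1 (d * 1))
    (by simp; subst hd; nlinarith) (by simp; subst hd; nlinarith)
  rw [coeff_X_pow_add_X_pow_pow (by omega), Nat.choose_succ_self_right,
    CharP.cast_eq_zero_iff K (2 * n + 1)] at hcoeff
  exact absurd (Nat.le_of_dvd (by omega) hcoeff) (by omega)
end

section
/- Let p ≥ 5 be a prime number, let K be a field of characteristic p, let b ≥ 1 and e ≥ 2 be integers, and set q = p^e, d = 2·b·p^(e−1) + 1, and u = (p+1)/2. Let R = K[X,Y,Z]/(X^d + Y^d + Z^d) with x, y, z the images of the variables. Then z^(u·d) does not belong to the ideal of R generated by x^(bq) and y^(bq). -/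
open MvPolynomial

/-- A monic polynomial of positive degree defines a root extension containing the base ring. -/
theorem eq_zero_of_adjoinRoot_of_eq_zero {A : Type*} [CommRing A] {f : Polynomial A}
    (hf : f.Monic) (hdeg : 0 < f.natDegree) {a : A} (ha : AdjoinRoot.of f a = 0) : a = 0 := by
  by_contra h
  rw [AdjoinRoot.of, RingHom.comp_apply, AdjoinRoot.mk_eq_zero] at ha
  exact hf.not_dvd_of_natDegree_lt (Polynomial.C_ne_zero.mpr h)
    (by rwa [Polynomial.natDegree_C]) ha

/-- The monomial `X ^ (d * (u - 1)) * Y ^ d` occurs in `(X ^ d + Y ^ d) ^ u` and lies outside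
`(X ^ N, Y ^ N)`. -/
theorem add_pow_notMem_span_pow {K : Type*} [Field K] {d u N : ℕ} (hd : 0 < d) (hu : 1 ≤ u)
    (hK : (u : K) ≠ 0) (h₁ : d * (u - 1) < N) (h₂ : d < N) :
    ((Polynomial.X : Polynomial (Polynomial K)) ^ d + Polynomial.C Polynomial.X ^ d) ^ u ∉
      Ideal.span {(Polynomial.X : Polynomial (Polynomial K)) ^ N,
        Polynomial.C Polynomial.X ^ N} := by
  intro h
  obtain ⟨a, b, hab⟩ := Ideal.mem_span_pair.mp h
  have hexp : ((Polynomial.X : Polynomial (Polynomial K)) ^ d + Polynomial.C Polynomial.X ^ d) ^ u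
      = Polynomial.expand _ d
        ((Polynomial.X + Polynomial.C ((Polynomial.X : Polynomial K) ^ d)) ^ u) := by
    simp
  rw [hexp] at hab
  have hcoeff := congrArg (fun g ↦ (g.coeff (d * (u - 1))).coeff d) hab
  have hsub : u - (u - 1) = 1 := by omega
  have hchoose : u.choose (u - 1) = u := by
    rw [Nat.choose_symm hu, Nat.choose_one_right]
  simp only [Polynomial.coeff_expand_mul' hd, Polynomial.coeff_X_add_C_pow, hsub, hchoose,
    Polynomial.coeff_add, ← Polynomial.C_pow, Polynomial.coeff_mul_C,
    Polynomial.coeff_mul_X_pow', if_neg (not_le.mpr h₁), if_neg (not_le.mpr h₂), pow_one,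
    Polynomial.coeff_zero, add_zero, Polynomial.coeff_mul_natCast, Polynomial.coeff_X_pow_self,
    one_mul] at hcoeff
  exact hK hcoeff.symm

/-- If `z ^ (u * d)` lies in `(x ^ N, y ^ N)` on the Fermat curve, then `(s ^ d + t ^ d) ^ u`
vanishes for all elements `s`, `t` of a `K`-algebra with `s ^ N = t ^ N = 0`. -/
theorem add_pow_eq_zero_of_fermat {K A : Type*} [Field K] [CommRing A] [Algebra K A]
    {d u N : ℕ} (hd : 0 < d)
    (h : (Ideal.Quotient.mk (Ideal.span {(X 0 : MvPolynomial (Fin 3) K) ^ d + X 1 ^ d + X 2 ^ d})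
        (X 2)) ^ (u * d) ∈
      Ideal.span {Ideal.Quotient.mk (Ideal.span
          {(X 0 : MvPolynomial (Fin 3) K) ^ d + X 1 ^ d + X 2 ^ d}) (X 0) ^ N,
        Ideal.Quotient.mk (Ideal.span
          {(X 0 : MvPolynomial (Fin 3) K) ^ d + X 1 ^ d + X 2 ^ d}) (X 1) ^ N})
    {s t : A} (hs : s ^ N = 0) (ht : t ^ N = 0) : (s ^ d + t ^ d) ^ u = 0 := by
  rcases subsingleton_or_nontrivial A with _ | _
  · exact Subsingleton.elim _ _
  let f : Polynomial A := Polynomial.X ^ d + Polynomial.C (s ^ d + t ^ d)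
  have hf : f.Monic := Polynomial.monic_X_pow_add_C _ hd.ne'
  have hfd : 0 < f.natDegree := by rwa [Polynomial.natDegree_X_pow_add_C]
  have hroot : AdjoinRoot.root f ^ d + AdjoinRoot.of f (s ^ d + t ^ d) = 0 := by
    have hf₀ := AdjoinRoot.eval₂_root f
    rwa [Polynomial.eval₂_add, Polynomial.eval₂_X_pow, Polynomial.eval₂_C] at hf₀
  let φ : MvPolynomial (Fin 3) K →+* AdjoinRoot f :=
    eval₂Hom ((AdjoinRoot.of f).comp (algebraMap K A))
      ![AdjoinRoot.of f s, AdjoinRoot.of f t, AdjoinRoot.root f]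
  have h0 : φ (X 0) = AdjoinRoot.of f s := by simp [φ]
  have h1 : φ (X 1) = AdjoinRoot.of f t := by simp [φ]
  have h2 : φ (X 2) = AdjoinRoot.root f := by simp [φ]
  have hφ : ∀ a ∈ Ideal.span {(X 0 : MvPolynomial (Fin 3) K) ^ d + X 1 ^ d + X 2 ^ d},
      φ a = 0 := by
    intro a ha
    obtain ⟨c, rfl⟩ := Ideal.mem_span_singleton'.mp ha
    rw [map_mul, map_add, map_add, map_pow, map_pow, map_pow, h0, h1, h2, ← map_pow, ← map_pow,
      ← map_add, add_comm, hroot, mul_zero]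
  obtain ⟨a, c, hac⟩ := Ideal.mem_span_pair.mp h
  have himage := congrArg (Ideal.Quotient.lift _ φ hφ) hac
  simp only [map_add, map_mul, map_pow, Ideal.Quotient.lift_mk, h0, h1, h2] at himage
  rw [← map_pow, ← map_pow, hs, ht, map_zero, mul_zero, mul_zero, add_zero,
    mul_comm u d, pow_mul, eq_neg_of_add_eq_zero_left hroot, ← map_neg, ← map_pow] at himage
  have hzero := eq_zero_of_adjoinRoot_of_eq_zero hf hfd himage.symm
  rwa [neg_pow, IsUnit.mul_right_eq_zero (isUnit_one.neg.pow u)] at hzero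

/-- If `z ^ (u * d)` lies in `(x ^ N, y ^ N)` on the Fermat curve, then `(s ^ d + t ^ d) ^ u`
lies in every ideal of a `K`-algebra containing `s ^ N` and `t ^ N`. -/
theorem add_pow_mem_of_fermat {K A : Type*} [Field K] [CommRing A] [Algebra K A]
    {d u N : ℕ} (hd : 0 < d)
    (h : (Ideal.Quotient.mk (Ideal.span {(X 0 : MvPolynomial (Fin 3) K) ^ d + X 1 ^ d + X 2 ^ d})
        (X 2)) ^ (u * d) ∈
      Ideal.span {Ideal.Quotient.mk (Ideal.span
          {(X 0 : MvPolynomial (Fin 3) K) ^ d + X 1 ^ d + X 2 ^ d}) (X 0) ^ N,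
        Ideal.Quotient.mk (Ideal.span
          {(X 0 : MvPolynomial (Fin 3) K) ^ d + X 1 ^ d + X 2 ^ d}) (X 1) ^ N})
    {I : Ideal A} {s t : A} (hs : s ^ N ∈ I) (ht : t ^ N ∈ I) : (s ^ d + t ^ d) ^ u ∈ I := by
  rw [← Ideal.Quotient.eq_zero_iff_mem, map_pow] at hs ht ⊢
  rw [map_add, map_pow, map_pow]
  exact add_pow_eq_zero_of_fermat hd h hs ht

/-- Let p ≥ 5 be a prime number, let K be a field of characteristic p, let b ≥ 1 and e ≥ 2
be integers, and set q = p^e, d = 2·b·p^(e−1) + 1, and u = (p+1)/2. Let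
R = K[X,Y,Z]/(X^d + Y^d + Z^d) with x, y, z the images of the variables. Then z^(u·d)
does not belong to the ideal of R generated by x^(bq) and y^(bq). -/
theorem stmt_10 (p : ℕ) (hp : p.Prime) (hp5 : 5 ≤ p) (K : Type*) [Field K] [CharP K p]
    (b e q d u : ℕ) (hb : 1 ≤ b) (he : 2 ≤ e) (hq : q = p ^ e)
    (hd : d = 2 * b * p ^ (e - 1) + 1) (hu : u = (p + 1) / 2)
    (x y z : MvPolynomial (Fin 3) K ⧸
      Ideal.span {(X 0 : MvPolynomial (Fin 3) K) ^ d + X 1 ^ d + X 2 ^ d})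
    (hx : x = Ideal.Quotient.mk _ (X 0)) (hy : y = Ideal.Quotient.mk _ (X 1))
    (hz : z = Ideal.Quotient.mk _ (X 2)) :
    z ^ (u * d) ∉ Ideal.span {x ^ (b * q), y ^ (b * q)} := by
  subst hx hy hz
  intro h
  have hdpos : 0 < d := by omega
  obtain ⟨v, hv⟩ : ∃ v, p = 2 * v + 1 := hp.odd_of_ne_two (by omega)
  have huv : u = v + 1 := by omega
  have hP : p ≤ p ^ (e - 1) := Nat.le_self_pow (by omega) p
  have hbP : p ^ (e - 1) ≤ b * p ^ (e - 1) := Nat.le_mul_of_pos_left _ hb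
  have hbq : b * q = (2 * v + 1) * (b * p ^ (e - 1)) := by
    rw [hq, ← hv, ← mul_pow_sub_one (by omega : e ≠ 0) p]
    ring
  have hd' : d = 2 * (b * p ^ (e - 1)) + 1 := by rw [hd]; ring
  have hlt : v < b * p ^ (e - 1) := by omega
  refine add_pow_notMem_span_pow (K := K) (N := b * q) hdpos (by omega) ?_ ?_ ?_
    (add_pow_mem_of_fermat hdpos h (Ideal.subset_span (by simp)) (Ideal.subset_span (by simp)))
  · rw [Ne, CharP.cast_eq_zero_iff K p]
    exact Nat.not_dvd_of_pos_of_lt (by omega) (by omega)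
  · rw [hbq, hd', huv, Nat.add_sub_cancel]
    nlinarith
  · rw [hbq, hd']
    nlinarith
end

section
/- Let p ≥ 5 be a prime number, let K be a field of characteristic p, let b ≥ 1 and e ≥ 2 be integers, and set q = p^e and d = 2·b·p^(e−1) + 1. Let R = K[X,Y,Z]/(X^d + Y^d + Z^d) with x, y, z the images of the variables. Then (x·y·z)^(b·q) does not belong to the ideal of R generated by x^(2bq), y^(2bq), and z^(2bq). -/
open MvPolynomial

/-- The coefficient of `u ^ (2 * m) * v ^ m` in `u ^ i * v ^ j * (-(u + v)) ^ k`. -/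
def trinomialCoeff (K : Type*) [CommRing K] (m i j k : ℕ) : K :=
  if i + j + k = 3 * m ∧ j ≤ m then (-1) ^ k * (k.choose (m - j) : K) else 0

theorem trinomialCoeff_add (K : Type*) [CommRing K] (m i j k : ℕ) :
    trinomialCoeff K m (i + 1) j k + trinomialCoeff K m i (j + 1) k +
      trinomialCoeff K m i j (k + 1) = 0 := by
  unfold trinomialCoeff
  by_cases h : i + j + k + 1 = 3 * m
  · rcases lt_trichotomy j m with hj | rfl | hj
    · obtain ⟨t, rfl⟩ := Nat.exists_eq_add_of_lt hj
      rw [if_pos (by omega), if_pos (by omega), if_pos (by omega),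
        show j + t + 1 - j = t + 1 by omega, show j + t + 1 - (j + 1) = t by omega,
        Nat.choose_succ_succ]
      push_cast
      ring
    · rw [if_pos (by omega), if_neg (by omega), if_pos (by omega)]
      simp [pow_succ]
    · rw [if_neg (by omega), if_neg (by omega), if_neg (by omega)]
      simp
  · rw [if_neg (by omega), if_neg (by omega), if_neg (by omega)]
    simp

theorem trinomialCoeff_eq_zero_of_left (K : Type*) [CommRing K] {m i : ℕ} (j k : ℕ)
    (hi : 2 * m < i) : trinomialCoeff K m i j k = 0 := by
  unfold trinomialCoeff
  split_ifs with h
  · rw [Nat.choose_eq_zero_of_lt (by omega)]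
    simp
  · rfl

theorem trinomialCoeff_eq_zero_of_middle (K : Type*) [CommRing K] {m j : ℕ} (i k : ℕ)
    (hj : m < j) : trinomialCoeff K m i j k = 0 :=
  if_neg (by omega)

theorem trinomialCoeff_eq_zero_of_right (K : Type*) [CommRing K] {p : ℕ} [CharP K p]
    (hp : p.Prime) {m k : ℕ} (hm : p = 2 * m + 1) (i j : ℕ) (hk : p ≤ k) :
    trinomialCoeff K m i j k = 0 := by
  unfold trinomialCoeff
  split_ifs with h
  · rw [(CharP.cast_eq_zero_iff K p _).2
      (hp.dvd_choose (a := m - j) (by omega) (by omega) hk), mul_zero]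
  · rfl

/-- The linear functional sending `X ^ (d * i + r) * Y ^ (d * j + r) * Z ^ (d * k + r)` to
`trinomialCoeff K m i j k` and every other monomial to zero. -/
noncomputable def residueFunctional (K : Type*) [CommRing K] (m d r : ℕ) :
    MvPolynomial (Fin 3) K →ₗ[K] K :=
  (basisMonomials (Fin 3) K).constr K fun s ↦
    if s 0 % d = r ∧ s 1 % d = r ∧ s 2 % d = r then
      trinomialCoeff K m (s 0 / d) (s 1 / d) (s 2 / d) else 0

theorem residueFunctional_monomial (K : Type*) [CommRing K] (m d r : ℕ) (s : Fin 3 →₀ ℕ)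
    (a : K) :
    residueFunctional K m d r (monomial s a) = a *
      if s 0 % d = r ∧ s 1 % d = r ∧ s 2 % d = r then
        trinomialCoeff K m (s 0 / d) (s 1 / d) (s 2 / d) else 0 := by
  have h : monomial s a = a • basisMonomials (Fin 3) K s := by
    simp [coe_basisMonomials, smul_monomial]
  rw [h, map_smul, residueFunctional, Module.Basis.constr_basis, smul_eq_mul]

theorem residueFunctional_mul_fermat (K : Type*) [CommRing K] (m r : ℕ) {d : ℕ} (hd : 0 < d)
    (f : MvPolynomial (Fin 3) K) :
    residueFunctional K m d r (f * (X 0 ^ d + X 1 ^ d + X 2 ^ d)) = 0 := by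
  induction f using MvPolynomial.induction_on' with
  | monomial s a =>
    simp only [X_pow_eq_monomial, mul_add, monomial_mul, map_add, residueFunctional_monomial]
    simp only [Finsupp.add_apply, Finsupp.single_apply, mul_one]
    simp only [Fin.isValue, if_true, one_ne_zero, zero_ne_one, if_false, add_zero,
      Nat.add_mod_right, Nat.add_div_right _ hd, Fin.reduceEq]
    split_ifs
    · rw [← mul_add, ← mul_add]
      simp only [trinomialCoeff_add, mul_zero]
    · simp
  | add f g hf hg => rw [add_mul, map_add, hf, hg, add_zero]

theorem residueFunctional_mul_X_pow (K : Type*) [CommRing K] {p : ℕ} [CharP K p]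
    (hp : p.Prime) {m d r n : ℕ} (hm : p = 2 * m + 1) (hr : 0 < r)
    (hn : n = d * (2 * m) + 2 * r) (c : Fin 3) (f : MvPolynomial (Fin 3) K) :
    residueFunctional K m d r (f * X c ^ n) = 0 := by
  induction f using MvPolynomial.induction_on' with
  | monomial s a =>
    rw [X_pow_eq_monomial, monomial_mul, residueFunctional_monomial]
    split_ifs with h
    · have key : ∀ t : ℕ, (t + n) % d = r → 2 * m < (t + n) / d := by
        intro t ht
        by_contra! hlt
        have h1 := Nat.div_add_mod (t + n) d
        have h2 := Nat.mul_le_mul_left d hlt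
        omega
      have hz : trinomialCoeff K m ((s + Finsupp.single c n) 0 / d)
          ((s + Finsupp.single c n) 1 / d) ((s + Finsupp.single c n) 2 / d) = 0 := by
        fin_cases c
        · refine trinomialCoeff_eq_zero_of_left K _ _ ?_
          simpa using key (s 0) (by simpa using h.1)
        · refine trinomialCoeff_eq_zero_of_middle K _ _
            (lt_of_le_of_lt (by omega : m ≤ 2 * m) ?_)
          simpa using key (s 1) (by simpa using h.2.1)
        · refine trinomialCoeff_eq_zero_of_right K hp hm _ _ (hm.trans_le (Nat.succ_le_of_lt ?_))
          simpa using key (s 2) (by simpa using h.2.2)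
      rw [hz, mul_zero]
    · rw [mul_zero]
  | add f g hf hg => rw [add_mul, map_add, hf, hg, add_zero]

theorem residueFunctional_prod_X_pow (K : Type*) [CommRing K] {m d r n : ℕ} (hrd : r < d)
    (hn : n = d * m + r) :
    residueFunctional K m d r ((X 0 * X 1 * X 2) ^ n) = (-1) ^ m := by
  have hmod : n % d = r := by rw [hn, Nat.mul_add_mod, Nat.mod_eq_of_lt hrd]
  have hdiv : n / d = m := by
    rw [hn, Nat.mul_add_div (by omega), Nat.div_eq_of_lt hrd, add_zero]
  rw [mul_pow, mul_pow, X_pow_eq_monomial, X_pow_eq_monomial, X_pow_eq_monomial,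
    monomial_mul, monomial_mul, residueFunctional_monomial]
  simp [hmod, hdiv, trinomialCoeff, show m + m + m = 3 * m by ring]

/-- Let p ≥ 5 be a prime number, let K be a field of characteristic p, let b ≥ 1 and e ≥ 2
be integers, and set q = p^e and d = 2·b·p^(e−1) + 1. Let R = K[X,Y,Z]/(X^d + Y^d + Z^d)
with x, y, z the images of the variables. Then (x·y·z)^(b·q) does not belong to the ideal
of R generated by x^(2bq), y^(2bq), and z^(2bq). -/
theorem stmt_12 (p : ℕ) (hp : p.Prime) (hp5 : 5 ≤ p) (K : Type*) [Field K] [CharP K p]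
    (b e q d : ℕ) (hb : 1 ≤ b) (he : 2 ≤ e) (hq : q = p ^ e)
    (hd : d = 2 * b * p ^ (e - 1) + 1)
    (x y z : MvPolynomial (Fin 3) K ⧸
      Ideal.span {(X 0 : MvPolynomial (Fin 3) K) ^ d + X 1 ^ d + X 2 ^ d})
    (hx : x = Ideal.Quotient.mk _ (X 0)) (hy : y = Ideal.Quotient.mk _ (X 1))
    (hz : z = Ideal.Quotient.mk _ (X 2)) :
    (x * y * z) ^ (b * q) ∉
      Ideal.span {x ^ (2 * b * q), y ^ (2 * b * q), z ^ (2 * b * q)} := by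
  intro hmem
  obtain ⟨m, hm⟩ : ∃ m, p = 2 * m + 1 := (hp.eq_two_or_odd'.resolve_left (by omega))
  obtain ⟨a, ha⟩ : ∃ a, a = b * p ^ (e - 1) := ⟨_, rfl⟩
  have hpa : p ≤ a := by
    rw [ha]
    exact (Nat.le_self_pow (by omega) p).trans (Nat.le_mul_of_pos_left _ hb)
  have hda : d = 2 * a + 1 := by rw [hd, ha, mul_assoc]
  have hbq : b * q = p * a := by
    obtain ⟨k, rfl⟩ : ∃ k, e = k + 1 := ⟨e - 1, by omega⟩
    rw [hq, ha, Nat.add_sub_cancel, pow_succ]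
    ring
  obtain ⟨r, hr⟩ : ∃ r, a = r + m := ⟨a - m, by omega⟩
  have hn : b * q = d * m + r := by
    rw [hbq, hda, hm, hr]
    ring
  have hn2 : 2 * b * q = d * (2 * m) + 2 * r := by
    rw [mul_assoc, hn]
    ring
  subst hx hy hz
  obtain ⟨f, w, hw, hf⟩ := Ideal.mem_span_insert.1 hmem
  obtain ⟨g, h, rfl⟩ := Ideal.mem_span_pair.1 hw
  obtain ⟨f, rfl⟩ := Ideal.Quotient.mk_surjective f
  obtain ⟨g, rfl⟩ := Ideal.Quotient.mk_surjective g
  obtain ⟨h, rfl⟩ := Ideal.Quotient.mk_surjective h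
  simp only [← map_mul, ← map_pow, ← map_add] at hf
  obtain ⟨s, hs⟩ := Ideal.mem_span_singleton'.1 (Ideal.Quotient.eq.1 hf)
  have hL := congrArg (residueFunctional K m d r) hs
  have hX := residueFunctional_mul_X_pow K hp hm (by omega : 0 < r) hn2
  rw [residueFunctional_mul_fermat K m r (by omega), map_sub, map_add, map_add, hX, hX, hX,
    residueFunctional_prod_X_pow K (by omega) hn] at hL
  simp only [add_zero, sub_zero] at hL
  exact pow_ne_zero m (neg_ne_zero.2 one_ne_zero) hL.symm
end
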